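/- arXiv:2009.11998 — 2 statements merged into one kernel-verified Lean document; each statement's English description precedes it below -/
import Mathlib

section
/- For every integer k ≥ 6 and every prime power q with q ≥ k−2, there exists a q^{k−3}-divisible [2q^{k−1} − q^{k−2} + 1 + (k−5)·θ_{k−1}, k, (k−3)q^{k−1} − 3q^{k−2} + q^{k−3}]_q linear code, where θ_{k−1} = (q^k − 1)/(q − 1). -/
/-- `C` is an `[n, k, d]_q` linear code over `F`: a `k`-dimensional `F`-linear subspace of
`F^n` such that the minimum Hamming weight of a nonzero codeword equals `d`. -/
def IsLinearCodeWith (F : Type) [Field F] [DecidableEq F] (n k d : ℕ)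
    (C : Submodule F (Fin n → F)) : Prop :=
  Module.finrank F C = k ∧
  (∀ c ∈ C, c ≠ 0 → d ≤ hammingNorm c) ∧
  (∃ c ∈ C, c ≠ 0 ∧ hammingNorm c = d)

section Helpers
open Finset Polynomial

theorem proj_sum {F V : Type} [Field F] [Fintype F] [AddCommGroup V] [Module F V] [Fintype V]
    [DecidableEq V] [Fintype (Projectivization F V)]
    (g : V → ℕ) (hg : ∀ (c : F) v, c ≠ 0 → g (c • v) = g v) (h0 : g 0 = 0) :
    ∑ v, g v = (Fintype.card F - 1) * ∑ p : Projectivization F V, g p.rep := by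
  classical
  rw [mul_sum]
  have h1 : ∑ v, g v = ∑ v : {v : V // v ≠ 0}, g v.1 := by
    rw [← Finset.sum_subtype (Finset.univ.filter (fun v : V => v ≠ 0)) (by simp), Finset.sum_filter]
    apply sum_congr rfl
    intro v _
    split_ifs with h
    · rfl
    · rw [not_not.mp h, h0]
  rw [h1, ← Finset.sum_fiberwise (g := fun v : {v : V // v ≠ 0} => Projectivization.mk F v.1 v.2)]
  apply sum_congr rfl
  intro p _
  have hc : ∀ v ∈ Finset.univ.filter (fun v : {v : V // v ≠ 0} => Projectivization.mk F v.1 v.2 = p),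
      g v.1 = g p.rep := by
    intro v hv
    simp only [mem_filter, mem_univ, true_and] at hv
    rw [← p.mk_rep, Projectivization.mk_eq_mk_iff'] at hv
    obtain ⟨a, ha⟩ := hv
    rw [← ha]
    apply hg
    rintro rfl
    exact v.2 (by simpa using ha.symm)
  rw [sum_congr rfl hc, sum_const, smul_eq_mul]
  congr 1
  rw [← Fintype.card_units]
  symm
  apply Finset.card_bij (fun (u : Fˣ) _ => (⟨u • p.rep, by rw [Units.smul_def]; exact smul_ne_zero u.ne_zero p.rep_nonzero⟩ : {v : V // v ≠ 0}))
  · intro u _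
    simp only [mem_filter, mem_univ, true_and]
    conv_rhs => rw [← p.mk_rep]
    rw [Projectivization.mk_eq_mk_iff']
    exact ⟨u, rfl⟩
  · intro u _ w _ h
    have h := congrArg Subtype.val h
    simp only [Units.smul_def] at h
    exact Units.ext (smul_left_injective F p.rep_nonzero h)
  · intro v hv
    simp only [mem_filter, mem_univ, true_and] at hv
    rw [← p.mk_rep, Projectivization.mk_eq_mk_iff] at hv
    obtain ⟨a, ha⟩ := hv
    exact ⟨a, mem_univ _, Subtype.ext ha⟩

theorem dual_count {F W : Type} [Field F] [Fintype F] [DecidableEq F] [AddCommGroup W] [Module F W]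
    [Fintype W] (φ : Module.Dual F W) (h : φ ≠ 0) :
    (Finset.univ.filter (fun v => φ v ≠ 0)).card
      = (Fintype.card F - 1) * Fintype.card F ^ (Module.finrank F W - 1) := by
  classical
  have h1 := Module.Dual.finrank_ker_add_one_of_ne_zero h
  have h2 : Fintype.card (LinearMap.ker φ) = Fintype.card F ^ (Module.finrank F (LinearMap.ker φ)) :=
    Module.card_eq_pow_finrank
  have h3 : Fintype.card W = Fintype.card F ^ (Module.finrank F W) := Module.card_eq_pow_finrank
  have h4 : (Finset.univ.filter (fun v => φ v = 0)).card = Fintype.card (LinearMap.ker φ) := by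
    rw [Fintype.card_subtype]; simp
  have h5 := Finset.card_filter_add_card_filter_not (s := (Finset.univ : Finset W)) (fun v => φ v = 0)
  rw [card_univ, h3, h4, h2, ← h1, pow_succ] at h5
  rw [← h1, Nat.add_sub_cancel, Nat.sub_mul, one_mul, mul_comm (Fintype.card F)]
  simp only [ne_eq]
  omega

theorem mult_count {F V I : Type} [Field F] [Fintype F] [DecidableEq F] [AddCommGroup V] [Module F V]
    [Fintype V] [DecidableEq V] [Fintype (Projectivization F V)] [Fintype I] (S : I → Submodule F V)
    [∀ i v, Decidable (v ∈ S i)]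
    (s : ℕ) (hs : ∀ v ≠ 0, (Finset.univ.filter (fun i => v ∈ S i)).card ≤ s)
    (P : V → Prop) [DecidablePred P] (hP : ∀ (c : F) v, c ≠ 0 → (P (c • v) ↔ P v)) (h0 : ¬ P 0) :
    (Fintype.card F - 1) * (Finset.univ.filter (fun x : Σ p : Projectivization F V,
        Fin (s - (Finset.univ.filter (fun i => p.rep ∈ S i)).card) => P x.1.rep)).card
      + ∑ i, (Finset.univ.filter (fun v : S i => P v.1)).card
      = s * (Finset.univ.filter P).card := by
  classical
  set m : V → ℕ := fun v => (Finset.univ.filter (fun i => v ∈ S i)).card with hm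
  have e1 : (Finset.univ.filter (fun x : Σ p : Projectivization F V, Fin (s - m p.rep) => P x.1.rep)).card
      = ∑ p : Projectivization F V, if P p.rep then s - m p.rep else 0 := by
    rw [Finset.card_filter, Fintype.sum_sigma]
    apply sum_congr rfl
    intro p _
    by_cases h : P p.rep <;> simp [h]
  have e2 : ∑ i, (Finset.univ.filter (fun v : S i => P v.1)).card
      = ∑ v, if P v then m v else 0 := by
    have : ∀ i, (Finset.univ.filter (fun v : S i => P v.1)).card
        = ∑ v : V, if v ∈ S i ∧ P v then 1 else 0 := by
      intro i
      rw [← Finset.card_filter]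
      apply Finset.card_bij (fun v _ => v.1)
      · intro v hv; simpa using hv
      · intro v _ w _ h; exact Subtype.ext h
      · intro v hv
        simp only [mem_filter, mem_univ, true_and] at hv
        exact ⟨⟨v, hv.1⟩, by simpa using hv.2, rfl⟩
    simp_rw [this]
    rw [sum_comm]
    apply sum_congr rfl
    intro v _
    by_cases h : P v <;> simp [h, hm]
  have e3 := proj_sum (F := F) (fun v : V => if P v then s - m v else 0) (by
    intro c v hc
    have : m (c • v) = m v := by
      simp only [hm]
      congr 1
      ext i
      simp [Submodule.smul_mem_iff _ hc]
    simp only [hP c v hc, this]) (by simp [h0])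
  simp only [hm] at e1 e3 e2 ⊢
  rw [e1, e2, ← e3, ← sum_add_distrib, Finset.card_filter, mul_sum]
  apply sum_congr rfl
  intro v _
  by_cases h : P v
  · have : v ≠ 0 := by rintro rfl; exact h0 h
    have := hs v this
    simp only [h, if_true]; omega
  · simp [h]

theorem belov {F V I : Type} [Field F] [Fintype F] [DecidableEq F] [AddCommGroup V] [Module F V]
    [Finite V] [Fintype I] (S : I → Submodule F V)
    (s n : ℕ) (hs : ∀ v ≠ 0, {i | v ∈ S i}.ncard ≤ s)
    (hn : (Fintype.card F - 1) * n + ∑ i, (Fintype.card F ^ Module.finrank F (S i) - 1)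
      = s * (Fintype.card F ^ Module.finrank F V - 1)) :
    ∃ L : Module.Dual F V →ₗ[F] (Fin n → F), ∀ φ, φ ≠ 0 → 
      ∃ T : Finset I, (∀ i, i ∈ T ↔ ∃ v ∈ S i, φ v ≠ 0) ∧
        hammingNorm (L φ) + ∑ i ∈ T, Fintype.card F ^ (Module.finrank F (S i) - 1)
          = s * Fintype.card F ^ (Module.finrank F V - 1) := by
  classical
  have : Fintype V := Fintype.ofFinite V
  have : Fintype (Projectivization F V) := Fintype.ofFinite _
  have hq : 0 < Fintype.card F - 1 := by
    have := Fintype.one_lt_card (α := F); omega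
  have hs' : ∀ v ≠ 0, (Finset.univ.filter (fun i => v ∈ S i)).card ≤ s := by
    intro v hv
    have := hs v hv
    rwa [Set.ncard_eq_toFinset_card', Set.toFinset_ofPred] at this
  let ι := Σ p : Projectivization F V, Fin (s - (Finset.univ.filter (fun i => p.rep ∈ S i)).card)
  have hne : ∀ (W : Type) [AddCommGroup W] [Module F W] [Fintype W],
      (Finset.univ.filter (fun w : W => w ≠ 0)).card = Fintype.card F ^ Module.finrank F W - 1 := by
    intro W _ _ _
    rw [Finset.filter_ne', card_erase_of_mem (mem_univ _), card_univ, Module.card_eq_pow_finrank (K := F)]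
  have hcard : Fintype.card ι = n := by
    have := mult_count S s hs' (fun v => v ≠ 0) (by intro c v hc; simp [hc]) (by simp)
    rw [hne, Finset.filter_true_of_mem (fun x _ => x.1.rep_nonzero), card_univ] at this
    have h2 : ∀ i, (Finset.univ.filter (fun v : S i => v.1 ≠ 0)).card
       = Fintype.card F ^ Module.finrank F (S i) - 1 := by
      intro i
      rw [← hne]
      congr 1
      ext v
      simp
    simp_rw [h2] at this
    rw [← hn] at this
    exact Nat.eq_of_mul_eq_mul_left hq (Nat.add_right_cancel this)
  let e : Fin n ≃ ι := (Fintype.equivFinOfCardEq hcard).symm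
  refine ⟨LinearMap.pi (fun j => LinearMap.applyₗ ((e j).1.rep)), ?_⟩
  intro φ hφ
  refine ⟨Finset.univ.filter (fun i => ∃ v ∈ S i, φ v ≠ 0), by simp, ?_⟩
  have := mult_count S s hs' (fun v => φ v ≠ 0) (by intro c v hc; simp [hc]) (by simp)
  rw [dual_count φ hφ] at this
  have h2 : ∀ i, (Finset.univ.filter (fun v : S i => φ v.1 ≠ 0)).card
      = (Fintype.card F - 1) * if ∃ v ∈ S i, φ v ≠ 0 then Fintype.card F ^ (Module.finrank F (S i) - 1) else 0 := by
    intro i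
    split_ifs with h
    · rw [← dual_count (φ.comp (S i).subtype)]
      · rfl
      · intro h'
        obtain ⟨v, hv, hv'⟩ := h
        exact hv' (LinearMap.congr_fun h' ⟨v, hv⟩)
    · push Not at h
      rw [mul_zero, card_eq_zero, filter_eq_empty_iff]
      intro v _
      simpa using h v.1 v.2
  simp_rw [h2] at this
  rw [← mul_sum, ← mul_add, mul_left_comm s] at this
  have := Nat.eq_of_mul_eq_mul_left hq this
  rw [← this, Finset.sum_filter]
  congr 1
  unfold hammingNorm
  apply Finset.card_bij (fun j _ => e j)
  · intro j hj
    simpa using hj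
  · intro a _ b _ h; exact e.injective h
  · intro x hx
    exact ⟨e.symm x, by simpa using hx, by simp⟩

theorem finrank_degLT (F : Type) [Field F] (n : ℕ) : Module.finrank F (degreeLT F n) = n := by
  rw [(degreeLTEquiv F n).finrank_eq]; simp

/-- multiplicities -/
def eMul {F : Type} [Field F] [DecidableEq F] : Option F → ℕ
  | none => 1
  | some a => if a = 0 then 1 else 2

/-- subspaces -/
noncomputable def subS {F : Type} [Field F] [DecidableEq F] (k : ℕ) :
    Option F → Submodule F (degreeLT F k)
  | none => (degreeLT F (k-1)).comap (degreeLT F k).subtype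
  | some a => ((Ideal.span {(X - C a) ^ (eMul (some a))}).restrictScalars F).comap
      (degreeLT F k).subtype

theorem mem_subS_none {F : Type} [Field F] [DecidableEq F] (k : ℕ) (f : degreeLT F k) :
    f ∈ subS k none ↔ f.1 ∈ degreeLT F (k-1) := Iff.rfl

theorem mem_subS_some {F : Type} [Field F] [DecidableEq F] (k : ℕ) (a : F) (f : degreeLT F k) :
    f ∈ subS k (some a) ↔ (X - C a) ^ (eMul (some a)) ∣ f.1 := by
  rw [← Ideal.mem_span_singleton]; rfl

theorem eMul_le {F : Type} [Field F] [DecidableEq F] (i : Option F) : eMul i ≤ 2 := by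
  cases i <;> simp [eMul]; split_ifs <;> omega

theorem finrank_subS {F : Type} [Field F] [DecidableEq F] (k : ℕ) (hk : 6 ≤ k) (i : Option F) :
    Module.finrank F (subS k i) = k - eMul i := by
  rw [← Submodule.finrank_map_subtype_eq]
  cases i with
  | none =>
    have : (subS (F := F) k none).map (degreeLT F k).subtype = degreeLT F (k-1) := by
      unfold subS
      rw [Submodule.map_comap_subtype]
      exact inf_eq_right.mpr (degreeLT_mono (by omega))
    rw [this, finrank_degLT]; rfl
  | some a =>
    have he := eMul_le (some a)
    set e := eMul (some a) with hee
    have hm : ((X - C a) ^ e).Monic := (monic_X_sub_C a).pow e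
    have hd : ((X - C a) ^ e).natDegree = e := by simp
    have hinj : Function.Injective (LinearMap.mulLeft F ((X - C a) ^ e)) := by
      intro x y h
      exact mul_left_cancel₀ hm.ne_zero h
    have : (subS (F := F) k (some a)).map (degreeLT F k).subtype
        = (degreeLT F (k-e)).map (LinearMap.mulLeft F ((X - C a) ^ e)) := by
      have key : ∀ h : F[X], (X - C a) ^ e * h ∈ degreeLT F k ↔ h ∈ degreeLT F (k - e) := by
        intro h
        by_cases h0 : h = 0
        · simp [h0]
        · rw [mem_degreeLT, mem_degreeLT, degree_eq_natDegree h0,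
            degree_eq_natDegree (mul_ne_zero hm.ne_zero h0), natDegree_mul hm.ne_zero h0, hd]
          norm_cast
          omega
      ext f
      constructor
      · rintro ⟨g, hg, rfl⟩
        obtain ⟨h, hh⟩ := (mem_subS_some k a g).mp hg
        refine ⟨h, ?_, hh.symm⟩
        have := g.2
        rw [hh] at this
        exact (key h).mp this
      · rintro ⟨h, hh, rfl⟩
        refine ⟨⟨_, (key h).mpr hh⟩, ?_, rfl⟩
        exact (mem_subS_some k a _).mpr (Dvd.intro _ rfl)
    rw [this, ← (Submodule.equivMapOfInjective _ hinj _).finrank_eq, finrank_degLT]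

theorem mult_subS {F : Type} [Field F] [Fintype F] [DecidableEq F] (k : ℕ) (hk : 6 ≤ k) 
    (f : degreeLT F k) (hf : f ≠ 0) : {i | f ∈ subS k i}.ncard ≤ k - 3 := by
  classical
  have hf0 : f.1 ≠ 0 := fun h => hf (Subtype.ext h)
  rw [Set.ncard_eq_toFinset_card', Set.toFinset_ofPred]
  have h1 : (Finset.univ.filter (fun i => f ∈ subS k i)).card
      = (if f.1 ∈ degreeLT F (k-1) then 1 else 0)
        + (Finset.univ.filter (fun a => f ∈ subS k (some a))).card := by
    rw [Finset.card_filter, Fintype.sum_option, Finset.card_filter]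
    rfl
  set T := Finset.univ.filter (fun a => f ∈ subS k (some a)) with hT
  have h2 : ∏ a ∈ T, (X - C a) ^ (eMul (some a)) ∣ f.1 := by
    apply Finset.prod_dvd_of_coprime
    · intro a _ b _ hab
      exact (isCoprime_X_sub_C_of_isUnit_sub (sub_ne_zero.mpr hab).isUnit).pow
    · intro a ha
      exact (mem_subS_some k a f).mp (by simpa [hT] using ha)
  have h3 := natDegree_le_of_dvd h2 hf0
  rw [natDegree_prod _ _ (fun a _ => pow_ne_zero _ (X_sub_C_ne_zero a))] at h3
  simp only [natDegree_pow, natDegree_X_sub_C, mul_one] at h3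
  have h4 : 2 * T.card ≤ (∑ a ∈ T, eMul (some a)) + 1 := by
    have : 2 * T.card ≤ ∑ a ∈ T, (eMul (some a) + if a = 0 then 1 else 0) := by
      rw [mul_comm, ← smul_eq_mul, ← sum_const]
      apply sum_le_sum
      intro a _
      by_cases h : a = 0 <;> simp [eMul, h]
    rw [sum_add_distrib, Finset.sum_ite_eq'] at this
    split_ifs at this <;> omega
  have h5 := f.2
  rw [mem_degreeLT, degree_eq_natDegree hf0] at h5
  norm_cast at h5
  rw [h1]
  rw [mem_degreeLT, degree_eq_natDegree hf0]
  norm_cast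
  split_ifs <;> omega

theorem sum_eMul {F : Type} [Field F] [Fintype F] [DecidableEq F] (g : ℕ → ℕ) :
    ∑ i : Option F, g (eMul i) = 2 * g 1 + (Fintype.card F - 1) * g 2 := by
  rw [Fintype.sum_option, ← Finset.add_sum_erase _ _ (Finset.mem_univ (0 : F))]
  have : ∀ a ∈ Finset.univ.erase (0 : F), g (eMul (some a)) = g 2 := by
    intro a ha
    simp [eMul, Finset.ne_of_mem_erase ha]
  rw [sum_congr rfl this, sum_const, card_erase_of_mem (mem_univ _), card_univ]
  simp [eMul]
  ring

theorem exists_min {F : Type} [Field F] [Fintype F] [DecidableEq F] (k : ℕ) (hk : 6 ≤ k) :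
    ∃ φ : Module.Dual F (degreeLT F k), φ ≠ 0 ∧ ∀ i, ∃ v ∈ subS k i, φ v ≠ 0 := by
  have hdeg : ∀ (p : F[X]) (m : ℕ), 3 ≤ m → p.natDegree ≤ 2 → p ∈ degreeLT F m := by
    intro p m hm hp
    rw [mem_degreeLT]
    exact lt_of_le_of_lt degree_le_natDegree (by exact_mod_cast (by omega))
  have H : ∀ i, ∃ v ∈ subS (F := F) k i, ((lcoeff F 2).comp (degreeLT F k).subtype) v ≠ 0 := by
    intro i
    cases i with
    | none =>
      refine ⟨⟨X ^ 2, hdeg _ _ (by omega) (by simp)⟩, ?_, ?_⟩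
      · rw [mem_subS_none]; exact hdeg _ _ (by omega) (by simp)
      · simp
    | some a =>
      have hd : ((X - C a) ^ (eMul (some a)) * X ^ (2 - eMul (some a))).natDegree = 2 := by
        have := eMul_le (some a)
        rw [natDegree_mul (pow_ne_zero _ (X_sub_C_ne_zero a)) (by simp)]
        simp; omega
      have hm : ((X - C a) ^ (eMul (some a)) * X ^ (2 - eMul (some a))).Monic :=
        ((monic_X_sub_C a).pow _).mul (monic_X_pow _)
      refine ⟨⟨_, hdeg _ _ (by omega) hd.le⟩, ?_, ?_⟩
      · rw [mem_subS_some]; exact Dvd.intro _ rfl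
      · have := hm.coeff_natDegree
        rw [hd] at this
        simp [this]
  refine ⟨_, ?_, H⟩
  intro h0
  obtain ⟨v, _, hv⟩ := H none
  rw [h0] at hv
  exact hv rfl

end Helpers

open Polynomial

/-- For every integer `k ≥ 6` and every prime power `q ≥ k - 2`, there exists a
`q^{k-3}`-divisible `[2q^{k-1} - q^{k-2} + 1 + (k-5)θ_{k-1}, k,
(k-3)q^{k-1} - 3q^{k-2} + q^{k-3}]_q` code, where `θ_{k-1} = (q^k - 1)/(q - 1)`. -/
theorem statement6 (k q : ℕ) (hk : 6 ≤ k) (hq : IsPrimePow q) (hkq : k - 2 ≤ q)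
    (F : Type) [Field F] [Fintype F] [DecidableEq F] (hF : Fintype.card F = q) :
    ∃ C : Submodule F
        (Fin (2 * q ^ (k - 1) - q ^ (k - 2) + 1 + (k - 5) * ((q ^ k - 1) / (q - 1))) → F),
      IsLinearCodeWith F
        (2 * q ^ (k - 1) - q ^ (k - 2) + 1 + (k - 5) * ((q ^ k - 1) / (q - 1))) k
        ((k - 3) * q ^ (k - 1) - 3 * q ^ (k - 2) + q ^ (k - 3)) C ∧
      ∀ c ∈ C, q ^ (k - 3) ∣ hammingNorm c := by
  have hq2 : 2 ≤ q := hq.two_le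
  set n := 2 * q ^ (k - 1) - q ^ (k - 2) + 1 + (k - 5) * ((q ^ k - 1) / (q - 1)) with hn
  have hcount : (q - 1) * n + (2 * (q ^ (k-1) - 1) + (q - 1) * (q ^ (k-2) - 1))
      = (k - 3) * (q ^ k - 1) := by
    have hd : (q - 1) * ((q ^ k - 1) / (q - 1)) = q ^ k - 1 :=
      Nat.mul_div_cancel' (by simpa using Nat.sub_dvd_pow_sub_pow q 1 k)
    obtain ⟨m, rfl⟩ : ∃ m, k = m + 6 := ⟨k - 6, by omega⟩
    have e1 : m + 6 - 1 = m + 5 := rfl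
    have e2 : m + 6 - 2 = m + 4 := rfl
    have e3 : m + 6 - 3 = m + 3 := rfl
    have e5 : m + 6 - 5 = m + 1 := rfl
    rw [hn, e1, e2, e3, e5, mul_add, mul_left_comm, hd]
    have p4 : 1 ≤ q ^ (m+4) := Nat.one_le_pow _ _ (by omega)
    have p5 : 1 ≤ q ^ (m+5) := Nat.one_le_pow _ _ (by omega)
    have p6 : 1 ≤ q ^ (m+6) := Nat.one_le_pow _ _ (by omega)
    have p45 : q ^ (m+4) ≤ 2 * q ^ (m+5) := by
      have : q ^ (m+4) ≤ q ^ (m+5) := Nat.pow_le_pow_right (by omega) (by omega)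
      omega
    zify [p4, p5, p6, p45, (by omega : 1 ≤ q)]
    ring
  have hfin : Finite (degreeLT F k) := Finite.of_equiv _ (degreeLTEquiv F k).symm.toEquiv
  have hB := belov (F := F) (V := degreeLT F k) (I := Option F) (subS k) (k - 3) n
    (fun v hv => mult_subS k hk v hv) (by
      simp_rw [finrank_subS k hk]
      rw [sum_eMul (fun e => Fintype.card F ^ (k - e) - 1), finrank_degLT, hF]
      exact hcount)
  obtain ⟨L, hL⟩ := hB
  simp_rw [finrank_subS k hk, finrank_degLT, hF] at hL
  have hsum : ∑ i : Option F, q ^ (k - eMul i - 1) + q ^ (k - 3) = 3 * q ^ (k-2) := by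
    rw [sum_eMul (fun e => q ^ (k - e - 1)), hF]
    obtain ⟨m, rfl⟩ : ∃ m, k = m + 6 := ⟨k - 6, by omega⟩
    simp only [show m + 6 - 1 - 1 = m + 4 by omega, show m + 4 - 1 = m + 3 by omega,
      show m + 6 - 2 = m + 4 by omega, show m + 6 - 3 = m + 3 by omega]
    zify [(by omega : 1 ≤ q)]
    ring
  have hbig : 3 * q ^ (k - 2) < (k-3) * q ^ (k-1) := by
    have : q ^ (k-1) = q ^ (k-2) * q := by rw [← pow_succ]; congr 1; omega
    have p : 0 < q ^ (k-2) := by positivity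
    have : 2 * q ^ (k-2) ≤ q ^ (k-1) := by rw [this]; nlinarith
    have h3 : 3 * q ^ (k-1) ≤ (k-3) * q ^ (k-1) := Nat.mul_le_mul_right _ (by omega)
    omega
  have hlow : ∀ φ, φ ≠ 0 →
      (k - 3) * q ^ (k - 1) - 3 * q ^ (k - 2) + q ^ (k - 3) ≤ hammingNorm (L φ) := by
    intro φ hφ
    obtain ⟨T, -, hT⟩ := hL φ hφ
    have : ∑ i ∈ T, q ^ (k - eMul i - 1) ≤ ∑ i : Option F, q ^ (k - eMul i - 1) :=
      Finset.sum_le_sum_of_subset (Finset.subset_univ T)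
    omega
  have hinj : Function.Injective L := by
    rw [← LinearMap.ker_eq_bot, LinearMap.ker_eq_bot']
    intro φ h
    by_contra hφ
    have := hlow φ hφ
    rw [h, hammingNorm_zero] at this
    omega
  refine ⟨LinearMap.range L, ⟨?_, ?_, ?_⟩, ?_⟩
  · rw [LinearMap.finrank_range_of_inj hinj, Subspace.dual_finrank_eq, finrank_degLT]
  · rintro _ ⟨φ, rfl⟩ hc
    exact hlow φ (by rintro rfl; simp at hc)
  · obtain ⟨φ, hφ, hall⟩ := exists_min (F := F) k hk
    refine ⟨L φ, ⟨φ, rfl⟩, ?_, ?_⟩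
    · intro h; exact hφ (hinj (by simpa using h))
    · obtain ⟨T, hT1, hT⟩ := hL φ hφ
      have : T = Finset.univ := by
        ext i; simp only [Finset.mem_univ, iff_true]; exact (hT1 i).mpr (hall i)
      rw [this] at hT
      omega
  · rintro _ ⟨φ, rfl⟩
    by_cases hφ : φ = 0
    · simp [hφ]
    · obtain ⟨T, -, hT⟩ := hL φ hφ
      have h1 : q ^ (k-3) ∣ ∑ i ∈ T, q ^ (k - eMul i - 1) :=
        Finset.dvd_sum (fun i _ => pow_dvd_pow q (by have := eMul_le i; omega))
      rw [Nat.dvd_add_iff_left h1, hT]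
      exact Dvd.dvd.mul_left (pow_dvd_pow q (by omega)) _
end

section
/- For every integer k ≥ 6 and every prime power q with q ≥ k−2, there exists a q-divisible [q² + 3q − 2, k, q² − (k−4)q]_q linear code in which the number of codewords of minimum Hamming weight q² − (k−4)q is exactly (q−1)·(C(q−1, k−3) + 2·C(q−1, k−4) + C(q−1, k−5)), where C(a,b) denotes the binomial coefficient. -/
open Polynomial in
/-- The encoding map. -/
def encMap (F : Type) [Field F] (m : ℕ) :
    (Polynomial.degreeLT F (m + 1) × F × F) →ₗ[F] (((Fˣ ⊕ Fˣ) ⊕ (F ⊕ (F × F))) → F) where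
  toFun p i := match i with
    | Sum.inl (Sum.inl _) => p.2.1
    | Sum.inl (Sum.inr _) => p.2.2
    | Sum.inr (Sum.inl _) => (p.1 : F[X]).coeff m
    | Sum.inr (Sum.inr (x, t)) => (p.1 : F[X]).eval x + t * (x * (p.2.1 + x * p.2.2))
  map_add' p p' := by
    funext i
    rcases i with (i | i) | (i | ⟨x, t⟩) <;> simp
    ring
  map_smul' c p := by
    funext i
    rcases i with (i | i) | (i | ⟨x, t⟩) <;> simp
    ring

theorem hammingNorm_eq_sum {F ι : Type} [Field F] [DecidableEq F] [Fintype ι] (c : ι → F) :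
    hammingNorm c = ∑ i, if c i = 0 then 0 else 1 := by
  rw [hammingNorm, Finset.card_filter]
  exact Finset.sum_congr rfl fun i _ => by by_cases h : c i = 0 <;> simp [h]

theorem inner_count {F : Type} [Field F] [Fintype F] [DecidableEq F] (u d : F) :
    (∑ t : F, if u + t * d = 0 then 0 else 1) =
      if d = 0 then (if u = 0 then 0 else Fintype.card F) else Fintype.card F - 1 := by
  by_cases hd : d = 0
  · by_cases hu : u = 0 <;> simp [hd, hu]
  · have : ∀ t : F, (if u + t * d = 0 then 0 else 1) = if t ≠ -u / d then 1 else 0 := by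
      intro t
      have : u + t * d = 0 ↔ t = -u / d := by
        rw [eq_div_iff hd]
        constructor <;> intro h <;> linear_combination h
      by_cases h : t = -u / d
      · rw [if_pos (this.2 h), if_neg (by simpa using h)]
      · rw [if_neg (fun h' => h (this.1 h')), if_pos h]
    simp_rw [this]
    rw [← Finset.card_filter, if_neg hd, Finset.filter_ne', Finset.card_erase_of_mem (by simp),
      Finset.card_univ]

open Polynomial in
theorem encMap_weight {F : Type} [Field F] [Fintype F] [DecidableEq F] (m : ℕ)
    (f : Polynomial.degreeLT F (m + 1)) (a b : F) :
    hammingNorm (encMap F m (f, a, b)) =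
      (Fintype.card F - 1) * (if a = 0 then 0 else 1)
      + (Fintype.card F - 1) * (if b = 0 then 0 else 1)
      + (Fintype.card F * (if (f : F[X]).coeff m = 0 then 0 else 1)
      + ∑ x : F, if x * (a + x * b) = 0 then (if (f : F[X]).eval x = 0 then 0 else Fintype.card F)
          else Fintype.card F - 1) := by
  rw [hammingNorm_eq_sum, Fintype.sum_sum_type, Fintype.sum_sum_type, Fintype.sum_sum_type,
    Fintype.sum_prod_type]
  change ((∑ _ : Fˣ, if a = 0 then 0 else 1) + ∑ _ : Fˣ, if b = 0 then 0 else 1) +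
      ((∑ _ : F, if (f : F[X]).coeff m = 0 then 0 else 1) +
        ∑ x : F, ∑ t : F, if (f : F[X]).eval x + t * (x * (a + x * b)) = 0 then 0 else 1) = _
  simp only [inner_count, Finset.sum_const, Finset.card_univ, Fintype.card_units, smul_eq_mul]

/-- Number of projective zeros. -/
noncomputable def nz {F : Type} [Field F] [DecidableEq F] (m : ℕ) (f : Polynomial F) : ℕ :=
  f.roots.toFinset.card + if f.coeff m = 0 then 1 else 0

open Polynomial in
theorem nz_le {F : Type} [Field F] [DecidableEq F] (m : ℕ) (f : Polynomial F)
    (hf : f ≠ 0) (hd : f ∈ Polynomial.degreeLT F (m + 1)) : nz m f ≤ m := by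
  have h1 : f.natDegree ≤ m := by
    rw [mem_degreeLT] at hd
    exact Nat.lt_succ_iff.1 ((natDegree_lt_iff_degree_lt hf).2 hd)
  have h2 := f.roots.toFinset_card_le
  have h3 := f.card_roots'
  unfold nz
  split_ifs with h
  · have : f.natDegree ≠ m := by
      rintro rfl
      exact hf (leadingCoeff_eq_zero.1 h)
    omega
  · omega

open Polynomial in
theorem weight_zero {F : Type} [Field F] [Fintype F] [DecidableEq F] (m : ℕ)
    (f : Polynomial.degreeLT F (m + 1)) (hf : f ≠ 0) :
    hammingNorm (encMap F m (f, 0, 0)) + Fintype.card F * nz m (f : F[X]) =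
      Fintype.card F * (Fintype.card F + 1) := by
  have hf' : (f : F[X]) ≠ 0 := by simpa using hf
  have key : (∑ x : F, if (f : F[X]).eval x = 0 then 0 else Fintype.card F)
      + Fintype.card F * (f : F[X]).roots.toFinset.card = Fintype.card F * Fintype.card F := by
    have : (f : F[X]).roots.toFinset = Finset.univ.filter fun x => (f : F[X]).eval x = 0 := by
      ext x; simp [hf']
    rw [this, Finset.card_filter, Finset.mul_sum, ← Finset.sum_add_distrib]
    have : ∀ x : F, ((if (f : F[X]).eval x = 0 then 0 else Fintype.card F) +
      Fintype.card F * if (f : F[X]).eval x = 0 then 1 else 0) = Fintype.card F := by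
      intro x; split_ifs <;> simp
    rw [Finset.sum_congr rfl fun x _ => this x, Finset.sum_const, Finset.card_univ, smul_eq_mul]
  rw [encMap_weight]
  simp only [nz, mul_zero, add_zero, if_true]
  split_ifs <;> linarith

open Polynomial in
theorem weight_nonzero {F : Type} [Field F] [Fintype F] [DecidableEq F] (m : ℕ)
    (f : Polynomial.degreeLT F (m + 1)) (a b : F) (hab : a ≠ 0 ∨ b ≠ 0) :
    ∃ s, hammingNorm (encMap F m (f, a, b)) = Fintype.card F * (Fintype.card F - 1 + s) := by
  have hq : 1 ≤ Fintype.card F := Fintype.card_pos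
  have hsplit : (∑ x : F, if x * (a + x * b) = 0 then
        (if (f : F[X]).eval x = 0 then 0 else Fintype.card F) else Fintype.card F - 1) =
      Fintype.card F * (∑ x : F, if x * (a + x * b) = 0 then
        (if (f : F[X]).eval x = 0 then 0 else 1) else 0)
      + (Fintype.card F - 1) * (Finset.univ.filter fun x : F => ¬ (x * (a + x * b) = 0)).card := by
    rw [Finset.card_filter, Finset.mul_sum, Finset.mul_sum, ← Finset.sum_add_distrib]
    refine Finset.sum_congr rfl fun x _ => ?_
    by_cases h1 : x * (a + x * b) = 0 <;> by_cases h2 : (f : F[X]).eval x = 0 <;> simp [h1, h2]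
  have hcount : (if a = 0 then 0 else 1) + (if b = 0 then 0 else 1) +
      (Finset.univ.filter fun x : F => ¬ (x * (a + x * b) = 0)).card = Fintype.card F := by
    have hc := Finset.card_filter_add_card_filter_not (s := (Finset.univ : Finset F))
      (fun x : F => x * (a + x * b) = 0)
    rw [Finset.card_univ] at hc
    have hz : (Finset.univ.filter fun x : F => x * (a + x * b) = 0).card =
        (if a = 0 then 0 else 1) + (if b = 0 then 0 else 1) := by
      by_cases ha : a = 0
      · have hb : b ≠ 0 := by tauto
        have : (Finset.univ.filter fun x : F => x * (a + x * b) = 0) = {0} := by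
          ext x; simp [ha, hb]
        rw [this]; simp [ha, hb]
      · by_cases hb : b = 0
        · have : (Finset.univ.filter fun x : F => x * (a + x * b) = 0) = {0} := by
            ext x; simp [ha, hb]
          rw [this]; simp [ha, hb]
        · have : (Finset.univ.filter fun x : F => x * (a + x * b) = 0) = {0, -a / b} := by
            ext x
            have : a + x * b = 0 ↔ x = -a / b := by
              rw [eq_div_iff hb]
              constructor <;> intro h <;> linear_combination h
            simp [this]
          rw [this, Finset.card_pair]
          · simp [ha, hb]
          · intro h
            have := h.symm
            simp [ha, hb] at this
    omega
  rw [encMap_weight, hsplit]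
  generalize (Finset.univ.filter fun x : F => ¬ (x * (a + x * b) = 0)).card = N at *
  generalize (if a = 0 then 0 else 1 : ℕ) = A at *
  generalize (if b = 0 then 0 else 1 : ℕ) = B at *
  refine ⟨(if (f : F[X]).coeff m = 0 then 0 else 1) + (∑ x : F, if x * (a + x * b) = 0 then
        (if (f : F[X]).eval x = 0 then 0 else 1) else 0), ?_⟩
  generalize (∑ x : F, if x * (a + x * b) = 0 then
        (if (f : F[X]).eval x = 0 then 0 else 1) else 0) = S at *
  generalize (if (f : F[X]).coeff m = 0 then 0 else 1 : ℕ) = T at *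
  have : Fintype.card F * (Fintype.card F - 1) = (Fintype.card F - 1) * (A + B + N) := by
    rw [hcount, mul_comm]
  rw [mul_add, this]
  ring

open Polynomial in
/-- polynomial with given leading coefficient and root set -/
noncomputable def rootPoly {F : Type} [Field F] (p : Fˣ × Finset F) : F[X] :=
  C (p.1 : F) * ∏ x ∈ p.2, (X - C x)

open Polynomial in
theorem rootPoly_lc {F : Type} [Field F] (p : Fˣ × Finset F) :
    (rootPoly p).leadingCoeff = p.1 := by
  have : (∏ x ∈ p.2, (X - C x)).Monic := monic_prod_X_sub_C _ _
  simp [rootPoly, this.leadingCoeff]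

open Polynomial in
theorem rootPoly_ne {F : Type} [Field F] (p : Fˣ × Finset F) : rootPoly p ≠ 0 := by
  rw [← leadingCoeff_ne_zero, rootPoly_lc]; exact p.1.ne_zero

open Polynomial in
theorem rootPoly_roots {F : Type} [Field F] (p : Fˣ × Finset F) :
    (rootPoly p).roots = p.2.val := by
  rw [rootPoly, roots_C_mul _ p.1.ne_zero, roots_prod_X_sub_C]

open Polynomial in
theorem rootPoly_natDegree {F : Type} [Field F] (p : Fˣ × Finset F) :
    (rootPoly p).natDegree = p.2.card := by
  rw [rootPoly, natDegree_C_mul p.1.ne_zero, natDegree_finsetProd_X_sub_C_eq_card]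

theorem rootPoly_inj {F : Type} [Field F] : Function.Injective (rootPoly (F := F)) := by
  intro p p' h
  refine Prod.ext ?_ ?_
  · ext; rw [← rootPoly_lc, h, rootPoly_lc]
  · rw [← Finset.val_inj, ← rootPoly_roots, h, rootPoly_roots]

open Polynomial in
theorem nz_eq_iff {F : Type} [Field F] [Fintype F] [DecidableEq F] (m : ℕ) (hm : 1 ≤ m)
    (f : F[X]) :
    (f ≠ 0 ∧ f ∈ degreeLT F (m + 1) ∧ nz m f = m) ↔
      ∃ p : Fˣ × Finset F, (p.2.card = m ∨ p.2.card = m - 1) ∧ rootPoly p = f := by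
  constructor
  · rintro ⟨hf, hd, hn⟩
    have h1 : f.natDegree ≤ m := by
      rw [mem_degreeLT] at hd
      exact Nat.lt_succ_iff.1 ((natDegree_lt_iff_degree_lt hf).2 hd)
    have h2 := f.roots.toFinset_card_le
    have h3 := f.card_roots'
    have h4 : f.coeff m = 0 → f.natDegree ≠ m := by
      rintro h rfl
      exact hf (leadingCoeff_eq_zero.1 h)
    unfold nz at hn
    have h5 : f.roots.toFinset.card = f.natDegree ∧
        (f.roots.toFinset.card = m ∨ f.roots.toFinset.card = m - 1) := by
      split_ifs at hn with h
      · have := h4 h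
        omega
      · omega
    refine ⟨(Units.mk0 f.leadingCoeff (leadingCoeff_ne_zero.2 hf), f.roots.toFinset), h5.2, ?_⟩
    have hr : f.roots.toFinset.val = f.roots := by
      rw [Multiset.toFinset_val]
      refine Multiset.dedup_eq_self.2 (Multiset.toFinset_card_eq_card_iff_nodup.1 (by omega))
    have hc : Multiset.card f.roots = f.natDegree := by omega
    have := C_leadingCoeff_mul_prod_multiset_X_sub_C hc
    conv_rhs => rw [← this]
    simp only [rootPoly, Units.val_mk0, Finset.prod, hr]
  · rintro ⟨p, hp, rfl⟩
    refine ⟨rootPoly_ne p, ?_, ?_⟩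
    · rw [mem_degreeLT, degree_eq_natDegree (rootPoly_ne p), rootPoly_natDegree]
      have : p.2.card < m + 1 := by omega
      exact_mod_cast this
    · unfold nz
      rw [rootPoly_roots, Finset.val_toFinset]
      rcases hp with hp | hp
      · have : (rootPoly p).coeff m = p.1 := by
          rw [← rootPoly_lc, leadingCoeff, rootPoly_natDegree, hp]
        simp [this, hp]
      · have : (rootPoly p).coeff m = 0 := by
          apply coeff_eq_zero_of_natDegree_lt
          rw [rootPoly_natDegree]; omega
        simp [this, hp]
        omega

theorem count_pairs {F : Type} [Field F] [Fintype F] [DecidableEq F] (m : ℕ) (hm : 1 ≤ m) :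
    {p : Fˣ × Finset F | p.2.card = m ∨ p.2.card = m - 1}.ncard =
      (Fintype.card F - 1) * (Nat.choose (Fintype.card F) m + Nat.choose (Fintype.card F) (m - 1)) := by
  have : {p : Fˣ × Finset F | p.2.card = m ∨ p.2.card = m - 1} =
      (((Finset.univ : Finset Fˣ) ×ˢ (Finset.powersetCard m (Finset.univ : Finset F) ∪
        Finset.powersetCard (m - 1) (Finset.univ : Finset F)) : Finset (Fˣ × Finset F)) :
        Set (Fˣ × Finset F)) := by
    ext p; simp [Finset.mem_powersetCard]
  rw [this, Set.ncard_coe_finset, Finset.card_product, Finset.card_union_of_disjoint,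
    Finset.card_powersetCard, Finset.card_powersetCard, Finset.card_univ, Finset.card_univ,
    Fintype.card_units]
  rw [Finset.disjoint_left]
  intro s hs hs'
  rw [Finset.mem_powersetCard] at hs hs'
  omega

theorem hammingNorm_comp_equiv {F ι κ : Type} [Field F] [DecidableEq F] [Fintype ι] [Fintype κ]
    (e : κ ≃ ι) (c : ι → F) : hammingNorm (fun j => c (e j)) = hammingNorm c := by
  rw [hammingNorm_eq_sum, hammingNorm_eq_sum]
  exact Equiv.sum_comp e (fun i => if c i = 0 then 0 else 1)

theorem statement8 (k q : ℕ) (hk : 6 ≤ k) (hq : IsPrimePow q) (hkq : k - 2 ≤ q)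
    (F : Type) [Field F] [Fintype F] [DecidableEq F] (hF : Fintype.card F = q) :
    ∃ C : Submodule F (Fin (q ^ 2 + 3 * q - 2) → F),
      IsLinearCodeWith F (q ^ 2 + 3 * q - 2) k (q ^ 2 - (k - 4) * q) C ∧
      (∀ c ∈ C, q ∣ hammingNorm c) ∧
      {c : Fin (q ^ 2 + 3 * q - 2) → F |
          c ∈ C ∧ hammingNorm c = q ^ 2 - (k - 4) * q}.ncard
        = (q - 1) * (Nat.choose (q - 1) (k - 3) + 2 * Nat.choose (q - 1) (k - 4)
            + Nat.choose (q - 1) (k - 5)) := by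
  obtain ⟨m, rfl⟩ : ∃ m, k = m + 3 := ⟨k - 3, by omega⟩
  have hcard : Fintype.card ((Fˣ ⊕ Fˣ) ⊕ (F ⊕ (F × F))) = q ^ 2 + 3 * q - 2 := by
    simp only [Fintype.card_sum, Fintype.card_units, Fintype.card_prod, hF]
    have : q * q = q ^ 2 := by ring
    omega
  let e := (Fintype.equivFinOfCardEq hcard).symm
  let T : (Polynomial.degreeLT F (m + 1) × F × F) →ₗ[F] (Fin (q ^ 2 + 3 * q - 2) → F) :=
    (LinearMap.funLeft F F e).comp (encMap F m)
  have hT : ∀ p, hammingNorm (T p) = hammingNorm (encMap F m p) := fun p =>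
    hammingNorm_comp_equiv e (encMap F m p)
  obtain ⟨r, hr⟩ : ∃ r, q = r + (m - 1) := ⟨q - (m - 1), by omega⟩
  have hr2 : 2 ≤ r := by omega
  have hd : q ^ 2 - (m + 3 - 4) * q = q * r := by
    have : q ^ 2 = q * r + (m + 3 - 4) * q := by
      have : m + 3 - 4 = m - 1 := by omega
      rw [this, pow_two]
      conv_lhs => rw [hr]
      rw [hr]; ring
    omega
  have hw0 : ∀ f : Polynomial.degreeLT F (m + 1), f ≠ 0 →
      ∃ s, nz m (f : Polynomial F) + s = m ∧ hammingNorm (T (f, 0, 0)) = q * (r + s) := by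
    intro f hf
    have h1 := nz_le m (f : Polynomial F) (by simpa using hf) f.2
    have h2 := weight_zero m f hf
    obtain ⟨s, hs⟩ := Nat.exists_eq_add_of_le h1
    refine ⟨s, hs.symm, ?_⟩
    rw [hT]
    rw [hF] at h2
    have : q + 1 = r + s + nz m (f : Polynomial F) := by omega
    rw [this] at h2
    linarith
  have hw1 : ∀ (f : Polynomial.degreeLT F (m + 1)) (a b : F), (a ≠ 0 ∨ b ≠ 0) →
      ∃ s, hammingNorm (T (f, a, b)) = q * (r + 1 + s) := by
    intro f a b hab
    obtain ⟨s, hs⟩ := weight_nonzero m f a b hab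
    refine ⟨s + (m - 3), ?_⟩
    rw [hT, hs, hF]
    congr 1
    omega
  have hqpos : 0 < q := by omega
  have hcls : ∀ p, p = 0 ∨ (∃ f, f ≠ 0 ∧ p = (f, 0, 0)) ∨
      (∃ (f : Polynomial.degreeLT F (m + 1)) (a b : F), (a ≠ 0 ∨ b ≠ 0) ∧ p = (f, a, b)) := by
    rintro ⟨f, a, b⟩
    by_cases hab : a ≠ 0 ∨ b ≠ 0
    · exact Or.inr (Or.inr ⟨f, a, b, hab, rfl⟩)
    · push Not at hab
      obtain ⟨rfl, rfl⟩ := hab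
      by_cases hf : f = 0
      · left; rw [hf]; rfl
      · exact Or.inr (Or.inl ⟨f, hf, rfl⟩)
  have hlow : ∀ p, p ≠ 0 → q * r ≤ hammingNorm (T p) := by
    intro p hp
    rcases hcls p with h | ⟨f, hf, rfl⟩ | ⟨f, a, b, hab, rfl⟩
    · exact absurd h hp
    · obtain ⟨s, -, hs⟩ := hw0 f hf
      rw [hs]; exact Nat.mul_le_mul_left _ (by omega)
    · obtain ⟨s, hs⟩ := hw1 f a b hab
      rw [hs]; exact Nat.mul_le_mul_left _ (by omega)
  have hqr : 0 < q * r := Nat.mul_pos hqpos (by omega)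
  have hinj : Function.Injective T := by
    rw [← LinearMap.ker_eq_bot, LinearMap.ker_eq_bot']
    intro p hp
    by_contra h
    have := hlow p h
    rw [hp, hammingNorm_zero] at this
    omega
  have hset : {c : Fin (q ^ 2 + 3 * q - 2) → F |
      c ∈ LinearMap.range T ∧ hammingNorm c = q * r}.ncard =
      (q - 1) * (Nat.choose q m + Nat.choose q (m - 1)) := by
    have hmem : ∀ p : {p : Fˣ × Finset F // p.2.card = m ∨ p.2.card = m - 1},
        rootPoly p.1 ∈ Polynomial.degreeLT F (m + 1) := fun p =>
      ((nz_eq_iff m (by omega) _).2 ⟨p.1, p.2, rfl⟩).2.1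
    let g : {p : Fˣ × Finset F // p.2.card = m ∨ p.2.card = m - 1} →
        (Fin (q ^ 2 + 3 * q - 2) → F) := fun p => T (⟨rootPoly p.1, hmem p⟩, 0, 0)
    have hg : Function.Injective g := by
      intro p p' h
      have h1 := hinj h
      have h2 := congrArg Prod.fst h1
      have h3 := congrArg Subtype.val h2
      exact Subtype.ext (rootPoly_inj h3)
    have hrange : {c : Fin (q ^ 2 + 3 * q - 2) → F |
      c ∈ LinearMap.range T ∧ hammingNorm c = q * r} = Set.range g := by
      ext c
      constructor
      · rintro ⟨⟨p, rfl⟩, hp⟩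
        rcases hcls p with rfl | ⟨f, hf, rfl⟩ | ⟨f, a, b, hab, rfl⟩
        · rw [map_zero, hammingNorm_zero] at hp
          omega
        · obtain ⟨s, hs1, hs⟩ := hw0 f hf
          rw [hs] at hp
          have := Nat.eq_of_mul_eq_mul_left hqpos hp
          obtain ⟨p, hp1, hp2⟩ := (nz_eq_iff m (by omega) (f : Polynomial F)).1
            ⟨by simpa using hf, f.2, by omega⟩
          refine ⟨⟨p, hp1⟩, ?_⟩
          have : (⟨rootPoly p, hmem ⟨p, hp1⟩⟩ : Polynomial.degreeLT F (m + 1)) = f :=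
            Subtype.ext hp2
          simp only [g, this]
        · obtain ⟨s, hs⟩ := hw1 f a b hab
          rw [hs] at hp
          have := Nat.eq_of_mul_eq_mul_left hqpos hp
          omega
      · rintro ⟨p, rfl⟩
        refine ⟨⟨_, rfl⟩, ?_⟩
        have h := (nz_eq_iff m (by omega) (rootPoly p.1)).2 ⟨p.1, p.2, rfl⟩
        obtain ⟨s, hs1, hs⟩ := hw0 ⟨rootPoly p.1, hmem p⟩ (by
          intro h0; exact h.1 (congrArg Subtype.val h0))
        have h2 : nz m (rootPoly p.1) + s = m := hs1
        have : s = 0 := by have := h.2.2; omega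
        simp only [g]
        rw [hs, this, add_zero]
    rw [hrange, ← Set.image_univ, Set.ncard_image_of_injective _ hg, Set.ncard_univ]
    have := count_pairs (F := F) m (by omega)
    rw [hF] at this
    rw [← this]
    rfl
  have hchoose : Nat.choose q m + Nat.choose q (m - 1) =
      Nat.choose (q - 1) (m + 3 - 3) + 2 * Nat.choose (q - 1) (m + 3 - 4)
            + Nat.choose (q - 1) (m + 3 - 5) := by
    obtain ⟨Q, rfl⟩ : ∃ Q, q = Q + 1 := ⟨q - 1, by omega⟩
    obtain ⟨l, rfl⟩ : ∃ l, m = l + 2 := ⟨m - 2, by omega⟩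
    have e1 : l + 2 - 1 = l + 1 := by omega
    have e2 : l + 2 + 3 - 3 = l + 1 + 1 := by omega
    have e3 : l + 2 + 3 - 4 = l + 1 := by omega
    have e4 : l + 2 + 3 - 5 = l := by omega
    rw [e1, e2, e3, e4, Nat.add_sub_cancel, show l + 2 = l + 1 + 1 from rfl,
      Nat.choose_succ_succ Q (l + 1), Nat.choose_succ_succ Q l]
    simp only [Nat.succ_eq_add_one]
    ring
  refine ⟨LinearMap.range T, ⟨?_, ?_, ?_⟩, ?_, ?_⟩
  · rw [LinearMap.finrank_range_of_inj hinj]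
    have : Module.Finite F (Polynomial.degreeLT F (m + 1)) :=
      Module.Finite.equiv (Polynomial.degreeLTEquiv F (m + 1)).symm
    rw [Module.finrank_prod, Module.finrank_prod, (Polynomial.degreeLTEquiv F (m + 1)).finrank_eq]
    simp
  · rintro _ ⟨p, rfl⟩ hp
    rw [hd]
    exact hlow p (fun h => hp (by rw [h, map_zero]))
  · rw [hd]
    have hpos : {c : Fin (q ^ 2 + 3 * q - 2) → F |
      c ∈ LinearMap.range T ∧ hammingNorm c = q * r}.ncard ≠ 0 := by
      rw [hset]
      have : 0 < Nat.choose q (m - 1) := Nat.choose_pos (by omega)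
      have h2 : 0 < q - 1 := by omega
      positivity
    obtain ⟨c, hc1, hc2⟩ := Set.nonempty_of_ncard_ne_zero hpos
    refine ⟨c, hc1, ?_, hc2⟩
    rintro rfl
    rw [hammingNorm_zero] at hc2
    omega
  · rintro _ ⟨p, rfl⟩
    rcases hcls p with rfl | ⟨f, hf, rfl⟩ | ⟨f, a, b, hab, rfl⟩
    · simp
    · obtain ⟨s, -, hs⟩ := hw0 f hf
      exact ⟨_, hs⟩
    · obtain ⟨s, hs⟩ := hw1 f a b hab
      exact ⟨_, hs⟩
  · rw [hd, hset, hchoose]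
end
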